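/- Let 1 < α < 2 and Ω = (a,b) with -∞ < a < b < ∞. Then there exists a constant C > 0 (depending only on α and Ω) such that for all t > 0, H^{(α)}_{Ω,Ω^c}(t) = (2/π)·Γ(1 − 1/α)·t^{1/α} + R_α(t) with |R_α(t)| ≤ C·t. -/

import Mathlib

open MeasureTheory Real Filter Set Metric Topology

noncomputable def heatKernel1 (α t x : ℝ) : ℝ :=
  (1 / (2 * Real.pi)) * ∫ ξ : ℝ, Real.cos (x * ξ) * Real.exp (-t * |ξ| ^ α)

noncomputable def heatContent1 (α t : ℝ) (A B : Set ℝ) : ℝ :=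
  ∫ x in A, (∫ y in B, heatKernel1 α t (x - y))

/-- The damped power `ξ ↦ ξ ^ β * exp (-t * ξ ^ α)`. -/
noncomputable def dampedPow (α t β ξ : ℝ) : ℝ := ξ ^ β * Real.exp (-t * ξ ^ α)

/-- The integral of `dampedPow` against `sin (z * ξ)` over the half-line. -/
noncomputable def dampedSin (α t z β : ℝ) : ℝ :=
  ∫ ξ in Set.Ioi (0 : ℝ), Real.sin (z * ξ) * dampedPow α t β ξ

/-- The integral of `dampedPow` against `cos (z * ξ)` over the half-line. -/
noncomputable def dampedCos (α t z β : ℝ) : ℝ :=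
  ∫ ξ in Set.Ioi (0 : ℝ), Real.cos (z * ξ) * dampedPow α t β ξ

section Damped

variable {α t z β ξ : ℝ}

lemma dampedPow_nonneg (hξ : 0 ≤ ξ) : 0 ≤ dampedPow α t β ξ := by
  unfold dampedPow; positivity

lemma mul_dampedPow (hξ : 0 < ξ) : ξ * dampedPow α t β ξ = dampedPow α t (β + 1) ξ := by
  unfold dampedPow
  rw [Real.rpow_add hξ, Real.rpow_one]; ring

lemma measurable_dampedPow : Measurable (dampedPow α t β) := by
  unfold dampedPow; fun_prop

lemma integrableOn_dampedPow (hα : 0 < α) (ht : 0 < t) (hβ : -1 < β) :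
    IntegrableOn (dampedPow α t β) (Set.Ioi 0) :=
  integrableOn_rpow_mul_exp_neg_mul_rpow hβ hα ht

lemma integral_dampedPow (hα : 0 < α) (ht : 0 < t) (hβ : -1 < β) :
    ∫ ξ in Set.Ioi (0 : ℝ), dampedPow α t β ξ
      = t ^ (-(β + 1) / α) * (1 / α) * Real.Gamma ((β + 1) / α) :=
  integral_rpow_mul_exp_neg_mul_rpow hα hβ ht

lemma hasDerivAt_dampedPow (hξ : 0 < ξ) :
    HasDerivAt (dampedPow α t β)
      (β * dampedPow α t (β - 1) ξ - α * t * dampedPow α t (β + α - 1) ξ) ξ := by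
  have h := (Real.hasDerivAt_rpow_const (x := ξ) (p := β) (Or.inl hξ.ne')).mul
    (((Real.hasDerivAt_rpow_const (x := ξ) (p := α) (Or.inl hξ.ne')).const_mul (-t)).exp)
  refine h.congr_deriv ?_
  unfold dampedPow
  rw [show β + α - 1 = β + (α - 1) by ring, Real.rpow_add hξ β]
  ring

lemma tendsto_dampedPow_atTop (hα : 0 < α) (ht : 0 < t) :
    Tendsto (dampedPow α t β) atTop (𝓝 0) := by
  have h := (tendsto_rpow_mul_exp_neg_mul_atTop_nhds_zero (β / α) t ht).comp
    (tendsto_rpow_atTop hα)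
  refine h.congr' ?_
  filter_upwards [eventually_gt_atTop 0] with x hx
  simp only [Function.comp, dampedPow]
  rw [← Real.rpow_mul hx.le, mul_div_cancel₀ _ hα.ne']

lemma tendsto_dampedPow_zero (hβ : 0 < β) (ht : 0 < t) :
    Tendsto (dampedPow α t β) (𝓝[>] 0) (𝓝 0) := by
  have h : Tendsto (fun x : ℝ => x ^ β) (𝓝[>] 0) (𝓝 0) := by
    have := (Real.continuousAt_rpow_const 0 β (Or.inr hβ.le)).tendsto
    rw [Real.zero_rpow hβ.ne'] at this
    exact this.mono_left nhdsWithin_le_nhds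
  refine squeeze_zero' ?_ ?_ h
  · filter_upwards [self_mem_nhdsWithin] with x hx using dampedPow_nonneg (le_of_lt hx)
  · filter_upwards [self_mem_nhdsWithin] with x hx
    have hx : 0 < x := hx
    unfold dampedPow
    refine mul_le_of_le_one_right (by positivity) (Real.exp_le_one_iff.2 ?_)
    have : 0 ≤ t * x ^ α := by positivity
    linarith

lemma integrableOn_cos_mul_dampedPow (hα : 0 < α) (ht : 0 < t) (hβ : -1 < β) :
    IntegrableOn (fun ξ => Real.cos (z * ξ) * dampedPow α t β ξ) (Set.Ioi 0) :=
  (integrableOn_dampedPow hα ht hβ).bdd_mul (c := 1)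
    (by fun_prop) (ae_of_all _ fun ξ => Real.abs_cos_le_one _)

lemma abs_sin_mul_le (z ξ : ℝ) : |Real.sin (z * ξ)| ≤ |z| * |ξ| :=
  (Real.abs_sin_le_abs).trans (abs_mul z ξ).le

lemma abs_sin_mul_dampedPow_le (hξ : 0 < ξ) :
    |Real.sin (z * ξ) * dampedPow α t β ξ| ≤ |z| * dampedPow α t (β + 1) ξ := by
  rw [abs_mul, abs_of_nonneg (dampedPow_nonneg hξ.le), ← mul_dampedPow hξ, ← mul_assoc]
  have := abs_sin_mul_le z ξ
  rw [abs_of_pos hξ] at this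
  exact mul_le_mul_of_nonneg_right this (dampedPow_nonneg hξ.le)

lemma integrableOn_sin_mul_dampedPow (hα : 0 < α) (ht : 0 < t) (hβ : -2 < β) :
    IntegrableOn (fun ξ => Real.sin (z * ξ) * dampedPow α t β ξ) (Set.Ioi 0) := by
  refine ((integrableOn_dampedPow hα ht (show -1 < β + 1 by linarith)).const_mul |z|).mono' ?_ ?_
  · exact (Measurable.mul (by fun_prop) measurable_dampedPow).aestronglyMeasurable
  · filter_upwards [ae_restrict_mem measurableSet_Ioi] with ξ hξ
    exact abs_sin_mul_dampedPow_le hξ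

lemma mul_dampedCos (hα : 0 < α) (ht : 0 < t) (hβ : -1 < β) :
    z * dampedCos α t z β
      = -β * dampedSin α t z (β - 1) + α * t * dampedSin α t z (β + α - 1) := by
  have hs1 := integrableOn_sin_mul_dampedPow (z := z) hα ht (show -2 < β - 1 by linarith)
  have hs2 := integrableOn_sin_mul_dampedPow (z := z) hα ht (show -2 < β + α - 1 by linarith)
  have hc := integrableOn_cos_mul_dampedPow (z := z) hα ht hβ
  have hs : IntegrableOn (fun ξ => Real.sin (z * ξ) *
      (β * dampedPow α t (β - 1) ξ - α * t * dampedPow α t (β + α - 1) ξ)) (Set.Ioi 0) := by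
    refine ((hs1.const_mul β).sub (hs2.const_mul (α * t))).congr (ae_of_all _ fun ξ => ?_)
    simp only [Pi.sub_apply]; ring
  have hc' : IntegrableOn (fun ξ => Real.cos (z * ξ) * z * dampedPow α t β ξ) (Set.Ioi 0) := by
    refine (hc.const_mul z).congr (ae_of_all _ fun ξ => ?_)
    simp only; ring
  have key := integral_Ioi_mul_deriv_eq_deriv_mul (a := (0 : ℝ)) (a' := 0) (b' := 0)
    (u := fun ξ => Real.sin (z * ξ)) (v := dampedPow α t β)
    (u' := fun ξ => Real.cos (z * ξ) * z)
    (v' := fun ξ => β * dampedPow α t (β - 1) ξ - α * t * dampedPow α t (β + α - 1) ξ)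
    (fun ξ _ => by simpa using ((hasDerivAt_id ξ).const_mul z).sin)
    (fun ξ hξ => hasDerivAt_dampedPow hξ) hs hc'
    (by
      have h := (tendsto_dampedPow_zero (α := α) (show 0 < β + 1 by linarith) ht).const_mul |z|
      rw [mul_zero] at h
      refine squeeze_zero_norm' ?_ h
      filter_upwards [self_mem_nhdsWithin] with ξ hξ
      exact abs_sin_mul_dampedPow_le hξ)
    (by
      refine squeeze_zero_norm' ?_ (tendsto_dampedPow_atTop (β := β) hα ht)
      filter_upwards [eventually_gt_atTop 0] with ξ hξ
      rw [Pi.mul_apply, Real.norm_eq_abs, abs_mul, abs_of_nonneg (dampedPow_nonneg hξ.le)]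
      exact mul_le_of_le_one_left (dampedPow_nonneg hξ.le) (Real.abs_sin_le_one _))
  have e1 : ∫ ξ in Set.Ioi (0 : ℝ), Real.sin (z * ξ) *
      (β * dampedPow α t (β - 1) ξ - α * t * dampedPow α t (β + α - 1) ξ)
      = β * dampedSin α t z (β - 1) - α * t * dampedSin α t z (β + α - 1) := by
    unfold dampedSin
    rw [← integral_const_mul, ← integral_const_mul,
      ← integral_sub (hs1.const_mul β) (hs2.const_mul (α * t))]
    exact integral_congr_ae (ae_of_all _ fun ξ => by ring)
  have e2 : ∫ ξ in Set.Ioi (0 : ℝ), Real.cos (z * ξ) * z * dampedPow α t β ξ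
      = z * dampedCos α t z β := by
    unfold dampedCos
    rw [← integral_const_mul]
    exact integral_congr_ae (ae_of_all _ fun ξ => by ring)
  rw [e1, e2] at key
  linarith

lemma mul_dampedSin (hα : 0 < α) (ht : 0 < t) (hβ : 0 < β) :
    z * dampedSin α t z β
      = β * dampedCos α t z (β - 1) - α * t * dampedCos α t z (β + α - 1) := by
  have hs1 := integrableOn_cos_mul_dampedPow (z := z) hα ht (show -1 < β - 1 by linarith)
  have hs2 := integrableOn_cos_mul_dampedPow (z := z) hα ht (show -1 < β + α - 1 by linarith)
  have hc := integrableOn_sin_mul_dampedPow (z := z) hα ht (show -2 < β by linarith)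
  have hs : IntegrableOn (fun ξ => Real.cos (z * ξ) *
      (β * dampedPow α t (β - 1) ξ - α * t * dampedPow α t (β + α - 1) ξ)) (Set.Ioi 0) := by
    refine ((hs1.const_mul β).sub (hs2.const_mul (α * t))).congr (ae_of_all _ fun ξ => ?_)
    simp only [Pi.sub_apply]; ring
  have hc' : IntegrableOn (fun ξ => -Real.sin (z * ξ) * z * dampedPow α t β ξ) (Set.Ioi 0) := by
    refine (hc.const_mul (-z)).congr (ae_of_all _ fun ξ => ?_)
    simp only; ring
  have hle : ∀ ξ, 0 < ξ →
      ‖((fun ξ => Real.cos (z * ξ)) * dampedPow α t β) ξ‖ ≤ dampedPow α t β ξ := by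
    intro ξ hξ
    rw [Pi.mul_apply, Real.norm_eq_abs, abs_mul, abs_of_nonneg (dampedPow_nonneg hξ.le)]
    exact mul_le_of_le_one_left (dampedPow_nonneg hξ.le) (Real.abs_cos_le_one _)
  have key := integral_Ioi_mul_deriv_eq_deriv_mul (a := (0 : ℝ)) (a' := 0) (b' := 0)
    (u := fun ξ => Real.cos (z * ξ)) (v := dampedPow α t β)
    (u' := fun ξ => -Real.sin (z * ξ) * z)
    (v' := fun ξ => β * dampedPow α t (β - 1) ξ - α * t * dampedPow α t (β + α - 1) ξ)
    (fun ξ _ => by simpa using ((hasDerivAt_id ξ).const_mul z).cos)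
    (fun ξ hξ => hasDerivAt_dampedPow hξ) hs hc'
    (by
      refine squeeze_zero_norm' ?_ (tendsto_dampedPow_zero (α := α) hβ ht)
      filter_upwards [self_mem_nhdsWithin] with ξ hξ using hle ξ hξ)
    (by
      refine squeeze_zero_norm' ?_ (tendsto_dampedPow_atTop (β := β) hα ht)
      filter_upwards [eventually_gt_atTop 0] with ξ hξ using hle ξ hξ)
  have e1 : ∫ ξ in Set.Ioi (0 : ℝ), Real.cos (z * ξ) *
      (β * dampedPow α t (β - 1) ξ - α * t * dampedPow α t (β + α - 1) ξ)
      = β * dampedCos α t z (β - 1) - α * t * dampedCos α t z (β + α - 1) := by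
    unfold dampedCos
    rw [← integral_const_mul, ← integral_const_mul,
      ← integral_sub (hs1.const_mul β) (hs2.const_mul (α * t))]
    exact integral_congr_ae (ae_of_all _ fun ξ => by ring)
  have e2 : ∫ ξ in Set.Ioi (0 : ℝ), -Real.sin (z * ξ) * z * dampedPow α t β ξ
      = -z * dampedSin α t z β := by
    unfold dampedSin
    rw [← integral_const_mul]
    exact integral_congr_ae (ae_of_all _ fun ξ => by ring)
  rw [e1, e2] at key
  linarith

/-- A sine integral against a function dominated by `ξ ^ (α - 3)`, with `1 < α < 2`. -/
lemma abs_integral_sin_mul_le (h1 : 1 < α) (h2 : α < 2) (hz : 0 < z) {K : ℝ}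
    {g : ℝ → ℝ} (hg : ∀ ξ, 0 < ξ → |g ξ| ≤ K * ξ ^ (α - 3)) :
    |∫ ξ in Set.Ioi (0 : ℝ), Real.sin (z * ξ) * g ξ|
      ≤ K * (1 / (α - 1) + 1 / (2 - α)) * z ^ (2 - α) := by
  have hz' : 0 < z⁻¹ := inv_pos.2 hz
  have i1 : IntegrableOn (fun ξ : ℝ => K * z * ξ ^ (α - 2)) (Set.Ioc 0 z⁻¹) :=
    ((intervalIntegrable_iff_integrableOn_Ioc_of_le hz'.le).1
      (intervalIntegral.intervalIntegrable_rpow' (by linarith))).const_mul _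
  have i2 : IntegrableOn (fun ξ : ℝ => K * ξ ^ (α - 3)) (Set.Ioi z⁻¹) :=
    (integrableOn_Ioi_rpow_of_lt (by linarith) hz').const_mul _
  let B : ℝ → ℝ := fun ξ => if ξ ≤ z⁻¹ then K * z * ξ ^ (α - 2) else K * ξ ^ (α - 3)
  have j1 : IntegrableOn B (Set.Ioc 0 z⁻¹) :=
    i1.congr_fun (fun ξ hξ => by simp [B, hξ.2]) measurableSet_Ioc
  have j2 : IntegrableOn B (Set.Ioi z⁻¹) :=
    i2.congr_fun (fun ξ hξ => by simp [B, not_le.2 hξ.out]) measurableSet_Ioi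
  have v1 : ∫ ξ in Set.Ioc 0 z⁻¹, B ξ = K * (1 / (α - 1)) * z ^ (2 - α) := by
    rw [setIntegral_congr_fun (g := fun ξ : ℝ => K * z * ξ ^ (α - 2)) measurableSet_Ioc
      (fun ξ hξ => by simp [B, hξ.2]), integral_const_mul,
      ← intervalIntegral.integral_of_le hz'.le, integral_rpow (Or.inl (by linarith)),
      Real.zero_rpow (by linarith), Real.inv_rpow hz.le, ← Real.rpow_neg hz.le,
      show 2 - α = 1 + -(α - 2 + 1) by ring, Real.rpow_add hz, Real.rpow_one,
      show α - 2 + 1 = α - 1 by ring]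
    ring
  have v2 : ∫ ξ in Set.Ioi z⁻¹, B ξ = K * (1 / (2 - α)) * z ^ (2 - α) := by
    rw [setIntegral_congr_fun (g := fun ξ : ℝ => K * ξ ^ (α - 3)) measurableSet_Ioi
      (fun ξ hξ => by simp [B, not_le.2 hξ.out]), integral_const_mul,
      integral_Ioi_rpow_of_lt (by linarith) hz', Real.inv_rpow hz.le, ← Real.rpow_neg hz.le,
      show -(α - 3 + 1) = 2 - α by ring, show α - 3 + 1 = -(2 - α) by ring, neg_div_neg_eq]
    ring
  have hun : Set.Ioc 0 z⁻¹ ∪ Set.Ioi z⁻¹ = Set.Ioi (0 : ℝ) := Set.Ioc_union_Ioi_eq_Ioi hz'.le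
  have hB : IntegrableOn B (Set.Ioi 0) := by
    rw [← hun]; exact j1.union j2
  calc |∫ ξ in Set.Ioi (0 : ℝ), Real.sin (z * ξ) * g ξ|
      ≤ ∫ ξ in Set.Ioi (0 : ℝ), B ξ := by
        rw [← Real.norm_eq_abs]
        refine norm_integral_le_of_norm_le hB ?_
        filter_upwards [ae_restrict_mem measurableSet_Ioi] with ξ hξ
        have hξ : 0 < ξ := hξ
        rw [Real.norm_eq_abs, abs_mul]
        simp only [B]
        split_ifs
        · have := abs_sin_mul_le z ξ
          rw [abs_of_pos hz, abs_of_pos hξ] at this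
          calc _ ≤ z * ξ * (K * ξ ^ (α - 3)) := by
                gcongr; exact hg ξ hξ
            _ = _ := by
                rw [show α - 2 = α - 3 + 1 by ring, Real.rpow_add hξ, Real.rpow_one]; ring
        · calc _ ≤ 1 * (K * ξ ^ (α - 3)) := by
                gcongr
                · exact Real.abs_sin_le_one _
                · exact hg ξ hξ
            _ = _ := one_mul _
    _ = _ := by
        rw [← hun, setIntegral_union (Set.Ioc_disjoint_Ioi le_rfl) measurableSet_Ioi j1 j2, v1, v2]
        ring

lemma pow_mul_exp_neg_le_two {u : ℝ} (hu : 0 ≤ u) {k : ℕ} (hk : k ≤ 2) :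
    u ^ k * Real.exp (-u) ≤ 2 := by
  rw [Real.exp_neg, ← div_eq_mul_inv, div_le_iff₀ (Real.exp_pos u)]
  have h := Real.quadratic_le_exp_of_nonneg hu
  interval_cases k <;> nlinarith

lemma abs_pow_mul_dampedSin_le (h1 : 1 < α) (h2 : α < 2) (ht : 0 < t) (hz : 0 < z) {k : ℕ}
    (hk : k ≤ 2) (hβ : β = α - 3 + k * α) :
    |t ^ k * dampedSin α t z β| ≤ 2 * (1 / (α - 1) + 1 / (2 - α)) * z ^ (2 - α) := by
  unfold dampedSin
  rw [← integral_const_mul]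
  have := abs_integral_sin_mul_le h1 h2 hz (K := 2)
    (g := fun ξ => t ^ k * dampedPow α t β ξ) (fun ξ hξ => by
      have hE := pow_mul_exp_neg_le_two (u := t * ξ ^ α) (by positivity) hk
      rw [abs_of_nonneg (mul_nonneg (by positivity) (dampedPow_nonneg hξ.le))]
      have e : t ^ k * dampedPow α t β ξ
          = ((t * ξ ^ α) ^ k * Real.exp (-(t * ξ ^ α))) * ξ ^ (α - 3) := by
        unfold dampedPow
        rw [hβ, Real.rpow_add hξ, mul_comm (k : ℝ) α, Real.rpow_mul hξ.le, Real.rpow_natCast,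
          mul_pow, neg_mul]
        ring
      rw [e]
      gcongr)
  refine le_of_eq_of_le (congrArg _ ?_) this
  exact integral_congr_ae (ae_of_all _ fun ξ => by ring)

lemma exists_abs_dampedCos_zero_le (h1 : 1 < α) (h2 : α < 2) :
    ∃ C : ℝ, 0 < C ∧ ∀ t z : ℝ, 0 < t → 0 < z → |dampedCos α t z 0| ≤ C * t * z ^ (-1 - α) := by
  have hα : 0 < α := by linarith
  have ha1 : 0 < α - 1 := by linarith
  have ha2 : 0 < 2 - α := by linarith
  set M := 2 * (1 / (α - 1) + 1 / (2 - α)) with hM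
  have hMpos : 0 < M := by positivity
  refine ⟨α * ((α - 1) * (2 - α) + 3 * α * (α - 1) + α ^ 2) * M, by positivity, ?_⟩
  intro t z ht hz
  have c0 := mul_dampedCos (z := z) hα ht (show -1 < (0 : ℝ) by norm_num)
  have s1 := mul_dampedSin (z := z) hα ht ha1
  have c1 := mul_dampedCos (z := z) hα ht (show -1 < α - 2 by linarith)
  have c2 := mul_dampedCos (z := z) hα ht (show -1 < 2 * α - 2 by linarith)
  rw [show 0 + α - 1 = α - 1 by ring, neg_zero, zero_mul, zero_add] at c0
  rw [show α - 1 - 1 = α - 2 by ring, show α - 1 + α - 1 = 2 * α - 2 by ring] at s1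
  rw [show α - 2 - 1 = α - 3 by ring, show α - 2 + α - 1 = 2 * α - 3 by ring] at c1
  rw [show 2 * α - 2 - 1 = 2 * α - 3 by ring, show 2 * α - 2 + α - 1 = 3 * α - 3 by ring] at c2
  have b0 := abs_pow_mul_dampedSin_le (β := α - 3) h1 h2 ht hz (k := 0) (by norm_num)
    (by push_cast; ring)
  have b1 := abs_pow_mul_dampedSin_le (β := 2 * α - 3) h1 h2 ht hz (k := 1) (by norm_num)
    (by push_cast; ring)
  have b2 := abs_pow_mul_dampedSin_le (β := 3 * α - 3) h1 h2 ht hz (k := 2) (by norm_num)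
    (by push_cast; ring)
  rw [← hM] at b0 b1 b2
  rw [pow_zero, one_mul] at b0
  rw [pow_one] at b1
  set S0 := dampedSin α t z (α - 3)
  set S1 := t * dampedSin α t z (2 * α - 3) with hS1
  set S2 := t ^ 2 * dampedSin α t z (3 * α - 3) with hS2
  have hid : z ^ 3 * dampedCos α t z 0
      = α * t * ((α - 1) * (2 - α) * S0 + 3 * α * (α - 1) * S1 - α ^ 2 * S2) := by
    calc z ^ 3 * dampedCos α t z 0 = z * (z * (z * dampedCos α t z 0)) := by ring
      _ = α * t * (z * (z * dampedSin α t z (α - 1))) := by rw [c0]; ring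
      _ = α * t * ((α - 1) * (z * dampedCos α t z (α - 2))
            - α * t * (z * dampedCos α t z (2 * α - 2))) := by rw [s1]; ring
      _ = _ := by rw [c1, c2, hS1, hS2]; ring
  have hz3 : 0 < z ^ 3 := by positivity
  have hpow : z ^ (2 - α) = z ^ 3 * z ^ (-1 - α) := by
    rw [← Real.rpow_natCast, ← Real.rpow_add hz]; congr 1; push_cast; ring
  refine le_of_mul_le_mul_left ?_ hz3
  rw [← abs_of_pos hz3, ← abs_mul, abs_of_pos hz3, hid, abs_mul, abs_of_pos (mul_pos hα ht)]
  set W := M * z ^ (2 - α) with hW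
  calc α * t * |(α - 1) * (2 - α) * S0 + 3 * α * (α - 1) * S1 - α ^ 2 * S2|
      ≤ α * t * ((α - 1) * (2 - α) * W + 3 * α * (α - 1) * W + α ^ 2 * W) := by
        gcongr
        refine (abs_sub _ _).trans (add_le_add ((abs_add_le _ _).trans (add_le_add ?_ ?_)) ?_)
        all_goals
          rw [abs_mul, abs_of_nonneg (by positivity)]
          gcongr
    _ = _ := by rw [hW, hpow]; ring

end Damped

section Kernel

variable {α t : ℝ}

lemma heatKernel1_eq_dampedCos (x : ℝ) : heatKernel1 α t x = π⁻¹ * dampedCos α t x 0 := by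
  have h : ∫ ξ : ℝ, Real.cos (x * ξ) * Real.exp (-t * |ξ| ^ α) = 2 * dampedCos α t x 0 := by
    unfold dampedCos
    rw [← integral_comp_abs (f := fun ξ => Real.cos (x * ξ) * dampedPow α t 0 ξ)]
    refine integral_congr_ae (ae_of_all _ fun ξ => ?_)
    have hc : Real.cos (x * |ξ|) = Real.cos (x * ξ) := by
      rcases abs_cases ξ with h | h <;> rw [h.1]
      rw [mul_neg, Real.cos_neg]
    simp only [dampedPow, Real.rpow_zero, one_mul, hc]
  rw [heatKernel1, h, one_div, mul_inv]
  ring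

lemma heatKernel1_neg (x : ℝ) : heatKernel1 α t (-x) = heatKernel1 α t x := by
  simp [heatKernel1]

lemma heatKernel1_abs (x : ℝ) : heatKernel1 α t |x| = heatKernel1 α t x := by
  rcases abs_cases x with h | h <;> rw [h.1]
  exact heatKernel1_neg x

lemma continuous_heatKernel1 (hα : 0 < α) (ht : 0 < t) : Continuous (heatKernel1 α t) := by
  have : heatKernel1 α t = fun x => π⁻¹ * dampedCos α t x 0 := funext heatKernel1_eq_dampedCos
  rw [this]
  refine continuous_const.mul ?_
  unfold dampedCos
  refine continuous_of_dominated (bound := dampedPow α t 0) (fun x => ?_) (fun x => ?_)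
    (integrableOn_dampedPow hα ht (by norm_num)) (ae_of_all _ fun ξ => by fun_prop)
  · exact (Measurable.mul (by fun_prop) measurable_dampedPow).aestronglyMeasurable
  · filter_upwards [ae_restrict_mem measurableSet_Ioi] with ξ hξ
    have h0 : 0 ≤ dampedPow α t 0 ξ := dampedPow_nonneg (le_of_lt hξ)
    rw [Real.norm_eq_abs, abs_mul, abs_of_nonneg h0]
    exact mul_le_of_le_one_left h0 (Real.abs_cos_le_one _)

lemma exists_abs_heatKernel1_le (h1 : 1 < α) (h2 : α < 2) :
    ∃ C : ℝ, 0 < C ∧ ∀ t z : ℝ, 0 < t → 0 < z → |heatKernel1 α t z| ≤ C * t * z ^ (-1 - α) := by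
  obtain ⟨C, hC, h⟩ := exists_abs_dampedCos_zero_le h1 h2
  refine ⟨π⁻¹ * C, by positivity, fun t z ht hz => ?_⟩
  rw [heatKernel1_eq_dampedCos, abs_mul, abs_of_pos (by positivity : 0 < π⁻¹), mul_assoc,
    mul_assoc, ← mul_assoc C]
  exact mul_le_mul_of_nonneg_left (h t z ht hz) (by positivity)

lemma integrableOn_Ioi_of_abs_le_rpow {f : ℝ → ℝ} (hf : Continuous f) {K s : ℝ} (hs : s < -1)
    (h : ∀ z, 0 < z → |f z| ≤ K * z ^ s) : IntegrableOn f (Set.Ioi 0) := by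
  rw [← Set.Ioc_union_Ioi_eq_Ioi zero_le_one]
  refine IntegrableOn.union ?_ ?_
  · exact (hf.integrableOn_Icc (a := 0) (b := 1)).mono_set Set.Ioc_subset_Icc_self
  · refine ((integrableOn_Ioi_rpow_of_lt hs one_pos).const_mul K).mono'
      hf.aestronglyMeasurable ?_
    filter_upwards [ae_restrict_mem measurableSet_Ioi] with z hz
    exact h z (one_pos.trans hz)

lemma integrable_heatKernel1 (h1 : 1 < α) (h2 : α < 2) (ht : 0 < t) :
    Integrable (heatKernel1 α t) := by
  obtain ⟨C, hC, h⟩ := exists_abs_heatKernel1_le h1 h2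
  have hpos := integrableOn_Ioi_of_abs_le_rpow
    (continuous_heatKernel1 (α := α) (by linarith) ht)
    (show -1 - α < -1 by linarith) (fun z hz => h t z ht hz)
  have hneg : IntegrableOn (heatKernel1 α t) (Set.Iic 0) := by
    have := IntegrableOn.comp_neg_Iic (c := (0 : ℝ)) (f := heatKernel1 α t) (μ := volume)
      (by rw [neg_zero]; exact (integrableOn_Ici_iff_integrableOn_Ioi (by simp)).2 hpos)
    simpa only [heatKernel1_neg] using this
  rw [← integrableOn_univ, ← Set.Iic_union_Ioi (a := (0 : ℝ))]
  exact hneg.union hpos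

lemma integrableOn_mul_heatKernel1 (h1 : 1 < α) (h2 : α < 2) (ht : 0 < t) :
    IntegrableOn (fun z => z * heatKernel1 α t z) (Set.Ioi 0) := by
  obtain ⟨C, hC, h⟩ := exists_abs_heatKernel1_le h1 h2
  refine integrableOn_Ioi_of_abs_le_rpow (K := C * t) (s := -α)
    (continuous_id.mul (continuous_heatKernel1 (by linarith) ht)) (by linarith) fun z hz => ?_
  rw [abs_mul, abs_of_pos hz]
  calc z * |heatKernel1 α t z| ≤ z * (C * t * z ^ (-1 - α)) := by gcongr; exact h t z ht hz
    _ = _ := by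
      rw [show -α = 1 + (-1 - α) by ring, Real.rpow_add hz, Real.rpow_one]; ring

lemma integral_exp_neg_mul_sin {ε : ℝ} (hε : 0 < ε) (ξ : ℝ) :
    ∫ z in Set.Ioi (0 : ℝ), Real.exp (-ε * z) * Real.sin (z * ξ) = ξ / (ε ^ 2 + ξ ^ 2) := by
  have hd : ε ^ 2 + ξ ^ 2 ≠ 0 := by positivity
  have hexp : IntegrableOn (fun z : ℝ => Real.exp (-ε * z)) (Set.Ioi 0) :=
    exp_neg_integrableOn_Ioi 0 hε
  have key := integral_Ioi_of_hasDerivAt_of_tendsto' (a := (0 : ℝ)) (m := (0 : ℝ))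
    (f := fun z => Real.exp (-ε * z) *
      (-(ε * Real.sin (z * ξ) + ξ * Real.cos (z * ξ)) / (ε ^ 2 + ξ ^ 2)))
    (f' := fun z => Real.exp (-ε * z) * Real.sin (z * ξ))
    (fun z _ => by
      have e := ((hasDerivAt_id z).const_mul (-ε)).exp
      have s := ((hasDerivAt_id z).mul_const ξ).sin
      have c := ((hasDerivAt_id z).mul_const ξ).cos
      refine (e.mul ((((s.const_mul ε).add (c.const_mul ξ)).neg).div_const
        (ε ^ 2 + ξ ^ 2))).congr_deriv ?_
      simp only [id, Pi.add_apply, Pi.neg_apply]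
      field_simp
      ring)
    (by
      refine hexp.mul_bdd (c := 1) (by fun_prop) (ae_of_all _ fun z => Real.abs_sin_le_one _))
    (by
      have h0 : Tendsto (fun z : ℝ => Real.exp (-ε * z)) atTop (𝓝 0) :=
        Real.tendsto_exp_atBot.comp (tendsto_id.const_mul_atTop_of_neg (neg_lt_zero.2 hε))
      refine h0.zero_mul_isBoundedUnder_le ⟨(ε + |ξ|) / (ε ^ 2 + ξ ^ 2), ?_⟩
      refine eventually_map.2 (Eventually.of_forall fun z => ?_)
      simp only [Function.comp, Real.norm_eq_abs]
      rw [abs_div, abs_neg, abs_of_pos (by positivity : 0 < ε ^ 2 + ξ ^ 2)]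
      gcongr
      refine (abs_add_le _ _).trans (add_le_add ?_ ?_)
      · rw [abs_mul, abs_of_pos hε]
        exact mul_le_of_le_one_right hε.le (Real.abs_sin_le_one _)
      · rw [abs_mul]
        exact mul_le_of_le_one_right (abs_nonneg _) (Real.abs_cos_le_one _))
  rw [key]
  simp
  ring

lemma integral_exp_mul_mul_heatKernel1 (h1 : 1 < α) (ht : 0 < t) {ε : ℝ} (hε : 0 < ε) :
    ∫ z in Set.Ioi (0 : ℝ), Real.exp (-ε * z) * (z * heatKernel1 α t z)
      = π⁻¹ * (α * t) *
        ∫ ξ in Set.Ioi (0 : ℝ), ξ ^ 2 / (ε ^ 2 + ξ ^ 2) * dampedPow α t (α - 2) ξ := by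
  have hα : 0 < α := by linarith
  have hexp : IntegrableOn (fun z : ℝ => Real.exp (-ε * z)) (Set.Ioi 0) :=
    exp_neg_integrableOn_Ioi 0 hε
  have hp : ∀ z, z * heatKernel1 α t z = π⁻¹ * (α * t) * dampedSin α t z (α - 1) := fun z => by
    have c0 := mul_dampedCos (z := z) hα ht (show -1 < (0 : ℝ) by norm_num)
    rw [show 0 + α - 1 = α - 1 by ring, neg_zero, zero_mul, zero_add] at c0
    rw [heatKernel1_eq_dampedCos, mul_left_comm, c0]; ring
  have hint : Integrable (Function.uncurry fun z ξ : ℝ =>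
      Real.exp (-ε * z) * (Real.sin (z * ξ) * dampedPow α t (α - 1) ξ))
      ((volume.restrict (Set.Ioi 0)).prod (volume.restrict (Set.Ioi 0))) := by
    have h := Integrable.mul_prod hexp
      (integrableOn_dampedPow hα ht (show -1 < α - 1 by linarith))
    refine (h.bdd_mul (c := 1) (f := fun q : ℝ × ℝ => Real.sin (q.1 * q.2)) (by fun_prop)
      (ae_of_all _ fun q => Real.abs_sin_le_one _)).congr (ae_of_all _ fun q => ?_)
    simp only [Function.uncurry]; ring
  calc _ = ∫ z in Set.Ioi (0 : ℝ), π⁻¹ * (α * t) * ∫ ξ in Set.Ioi (0 : ℝ),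
        Real.exp (-ε * z) * (Real.sin (z * ξ) * dampedPow α t (α - 1) ξ) := by
        refine integral_congr_ae (ae_of_all _ fun z => ?_)
        simp only [hp, dampedSin, integral_const_mul]; ring
    _ = π⁻¹ * (α * t) * ∫ ξ in Set.Ioi (0 : ℝ), ∫ z in Set.Ioi (0 : ℝ),
        Real.exp (-ε * z) * (Real.sin (z * ξ) * dampedPow α t (α - 1) ξ) := by
        rw [integral_const_mul, integral_integral_swap hint]
    _ = _ := by
        congr 1
        refine setIntegral_congr_fun measurableSet_Ioi fun ξ hξ => ?_
        simp only [← mul_assoc]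
        rw [integral_mul_const, integral_exp_neg_mul_sin hε, show α - 1 = α - 2 + 1 by ring,
          ← mul_dampedPow hξ]
        ring

lemma integral_mul_heatKernel1 (h1 : 1 < α) (h2 : α < 2) (ht : 0 < t) :
    ∫ z in Set.Ioi (0 : ℝ), z * heatKernel1 α t z
      = π⁻¹ * Real.Gamma (1 - 1 / α) * t ^ (1 / α) := by
  have hα : 0 < α := by linarith
  have hE : IntegrableOn (dampedPow α t (α - 2)) (Set.Ioi 0) :=
    integrableOn_dampedPow hα ht (by linarith)
  have hcont := continuous_heatKernel1 hα ht
  have L1 : Tendsto (fun ε : ℝ => ∫ z in Set.Ioi (0 : ℝ),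
      Real.exp (-ε * z) * (z * heatKernel1 α t z)) (𝓝[>] 0)
      (𝓝 (∫ z in Set.Ioi (0 : ℝ), z * heatKernel1 α t z)) := by
    refine tendsto_integral_filter_of_dominated_convergence
      (fun z => |z * heatKernel1 α t z|) ?_ ?_ (integrableOn_mul_heatKernel1 h1 h2 ht).abs ?_
    · exact Eventually.of_forall fun ε => by fun_prop
    · filter_upwards [self_mem_nhdsWithin] with ε hε
      filter_upwards [ae_restrict_mem measurableSet_Ioi] with z hz
      have hεz : 0 < ε * z := mul_pos hε hz
      rw [Real.norm_eq_abs, abs_mul, Real.abs_exp]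
      exact mul_le_of_le_one_left (abs_nonneg _) (Real.exp_le_one_iff.2 (by linarith))
    · refine ae_of_all _ fun z => ?_
      have : Continuous fun ε : ℝ => Real.exp (-ε * z) * (z * heatKernel1 α t z) := by fun_prop
      have h := this.tendsto 0
      simp only [neg_zero, zero_mul, Real.exp_zero, one_mul] at h
      exact h.mono_left nhdsWithin_le_nhds
  have L2 : Tendsto (fun ε : ℝ => ∫ ξ in Set.Ioi (0 : ℝ),
      ξ ^ 2 / (ε ^ 2 + ξ ^ 2) * dampedPow α t (α - 2) ξ) (𝓝[>] 0)
      (𝓝 (∫ ξ in Set.Ioi (0 : ℝ), dampedPow α t (α - 2) ξ)) := by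
    refine tendsto_integral_filter_of_dominated_convergence
      (dampedPow α t (α - 2)) ?_ ?_ hE ?_
    · exact Eventually.of_forall fun ε =>
        (Measurable.mul (by fun_prop) measurable_dampedPow).aestronglyMeasurable
    · refine Eventually.of_forall fun ε => ?_
      filter_upwards [ae_restrict_mem measurableSet_Ioi] with ξ hξ
      have hξ : 0 < ξ := hξ
      have h0 : 0 ≤ dampedPow α t (α - 2) ξ := dampedPow_nonneg hξ.le
      rw [Real.norm_eq_abs, abs_mul, abs_of_nonneg h0, abs_of_nonneg (by positivity)]
      exact mul_le_of_le_one_left h0 (div_le_one_of_le₀ (by nlinarith) (by positivity))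
    · filter_upwards [ae_restrict_mem measurableSet_Ioi] with ξ hξ
      have hξ : 0 < ξ := hξ
      have : ContinuousAt (fun ε : ℝ => ξ ^ 2 / (ε ^ 2 + ξ ^ 2) * dampedPow α t (α - 2) ξ) 0 := by
        refine ContinuousAt.mul (ContinuousAt.div (by fun_prop) (by fun_prop) ?_) (by fun_prop)
        positivity
      have h := this.tendsto
      rw [zero_pow two_ne_zero, zero_add, div_self (by positivity), one_mul] at h
      exact h.mono_left nhdsWithin_le_nhds
  have L3 := (L2.const_mul (π⁻¹ * (α * t))).congr' (by
    filter_upwards [self_mem_nhdsWithin] with ε hε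
    exact (integral_exp_mul_mul_heatKernel1 h1 ht hε).symm)
  rw [tendsto_nhds_unique L1 L3, integral_dampedPow hα ht (by linarith),
    show (α - 2 + 1) / α = 1 - 1 / α by field_simp; ring,
    show -(α - 2 + 1) / α = -1 + 1 / α by field_simp; ring, Real.rpow_add ht, Real.rpow_neg_one]
  field_simp

end Kernel

section Content

variable {α t a b : ℝ}

lemma integral_indicator_compl_Ioo_sub (hab : a < b) (z : ℝ) :
    ∫ x in Set.Ioo a b, (Set.Ioo a b)ᶜ.indicator (1 : ℝ → ℝ) (x - z) = min |z| (b - a) := by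
  have hpre : (fun x => (Set.Ioo a b)ᶜ.indicator (1 : ℝ → ℝ) (x - z))
      = (Set.Ioo (a + z) (b + z))ᶜ.indicator 1 := by
    ext x
    simp only [Set.indicator, Set.mem_compl_iff, Set.mem_Ioo, Pi.one_apply, lt_sub_iff_add_lt,
      sub_lt_iff_lt_add]
  rw [hpre, integral_indicator_one measurableSet_Ioo.compl,
    measureReal_restrict_apply measurableSet_Ioo.compl, Set.inter_comm, ← Set.sdiff_eq]
  have h := measureReal_sdiff_add_inter (μ := volume) (s := Set.Ioo a b)
    (t := Set.Ioo (a + z) (b + z)) measurableSet_Ioo (by simp)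
  rw [Set.Ioo_inter_Ioo, Real.volume_real_Ioo, Real.volume_real_Ioo] at h
  rw [eq_sub_of_add_eq h]
  rcases le_total 0 z with hz | hz
  · rw [abs_of_nonneg hz, max_eq_right (by linarith : a ≤ a + z),
      min_eq_left (by linarith : b ≤ b + z), max_eq_left (by linarith : 0 ≤ b - a)]
    rcases le_total z (b - a) with h' | h'
    · rw [min_eq_left h', max_eq_left (by linarith)]; ring
    · rw [min_eq_right h', max_eq_right (by linarith)]; ring
  · rw [abs_of_nonpos hz, max_eq_left (by linarith : a + z ≤ a),
      min_eq_right (by linarith : b + z ≤ b), max_eq_left (by linarith : 0 ≤ b - a)]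
    rcases le_total (-z) (b - a) with h' | h'
    · rw [min_eq_left h', max_eq_left (by linarith)]; ring
    · rw [min_eq_right h', max_eq_right (by linarith)]; ring

lemma heatContent1_Ioo_compl (h1 : 1 < α) (h2 : α < 2) (ht : 0 < t) (hab : a < b) :
    heatContent1 α t (Set.Ioo a b) (Set.Ioo a b)ᶜ
      = 2 * ∫ z in Set.Ioi (0 : ℝ), min z (b - a) * heatKernel1 α t z := by
  have hm : Measurable ((Set.Ioo a b)ᶜ.indicator (1 : ℝ → ℝ)) :=
    measurable_one.indicator measurableSet_Ioo.compl
  have hint : Integrable (Function.uncurry fun x z : ℝ =>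
      (Set.Ioo a b)ᶜ.indicator (1 : ℝ → ℝ) (x - z) * heatKernel1 α t z)
      ((volume.restrict (Set.Ioo a b)).prod volume) := by
    refine ((integrable_heatKernel1 h1 h2 ht).comp_snd (volume.restrict (Set.Ioo a b))).bdd_mul
      (c := 1) (f := fun q : ℝ × ℝ => (Set.Ioo a b)ᶜ.indicator (1 : ℝ → ℝ) (q.1 - q.2)) ?_ ?_
    · exact (hm.comp (by fun_prop)).aestronglyMeasurable
    · refine ae_of_all _ fun q => ?_
      refine (norm_indicator_le_norm_self _ _).trans ?_
      simp
  calc heatContent1 α t (Set.Ioo a b) (Set.Ioo a b)ᶜ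
      = ∫ x in Set.Ioo a b, ∫ z,
          (Set.Ioo a b)ᶜ.indicator (1 : ℝ → ℝ) (x - z) * heatKernel1 α t z := by
        unfold heatContent1
        refine integral_congr_ae (ae_of_all _ fun x => ?_)
        simp only
        rw [← integral_indicator measurableSet_Ioo.compl, ← integral_sub_left_eq_self
          (fun z => (Set.Ioo a b)ᶜ.indicator (1 : ℝ → ℝ) (x - z) * heatKernel1 α t z) volume x]
        refine integral_congr_ae (ae_of_all _ fun y => ?_)
        simp only [sub_sub_cancel, Set.indicator, Pi.one_apply, ite_mul, one_mul, zero_mul]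
    _ = ∫ z, min |z| (b - a) * heatKernel1 α t |z| := by
        rw [integral_integral_swap hint]
        refine integral_congr_ae (ae_of_all _ fun z => ?_)
        simp only [integral_mul_const, integral_indicator_compl_Ioo_sub hab, heatKernel1_abs]
    _ = _ := integral_comp_abs (f := fun z => min z (b - a) * heatKernel1 α t z)

end Content

/-- for `1 < α < 2` and `Ω = (a,b)` there is `C > 0` with
`H^{(α)}_{Ω,Ωᶜ}(t) = (2/π) Γ(1-1/α) t^{1/α} + R_α(t)`, `|R_α(t)| ≤ C t`, for all `t > 0`. -/
theorem heat_content_interval_stable (α : ℝ) (h1 : 1 < α) (h2 : α < 2)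
    (a b : ℝ) (hab : a < b) :
    ∃ C : ℝ, 0 < C ∧ ∀ t : ℝ, 0 < t →
      |heatContent1 α t (Set.Ioo a b) (Set.Ioo a b)ᶜ
          - (2 / Real.pi) * Real.Gamma (1 - 1/α) * t ^ (1/α)| ≤ C * t := by
  obtain ⟨C, hC, h⟩ := exists_abs_heatKernel1_le h1 h2
  have hL : 0 < b - a := sub_pos.2 hab
  have hα1 : 0 < α - 1 := by linarith
  refine ⟨2 * (C * ((b - a) ^ (-α + 1) / (α - 1))), by positivity, fun t ht => ?_⟩
  have i1 := integrableOn_mul_heatKernel1 h1 h2 ht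
  have hcont := continuous_heatKernel1 (α := α) (by linarith) ht
  have i2 : IntegrableOn (fun z => min z (b - a) * heatKernel1 α t z) (Set.Ioi 0) := by
    refine i1.abs.mono' (by fun_prop) ?_
    filter_upwards [ae_restrict_mem measurableSet_Ioi] with z hz
    have hz : 0 < z := hz
    rw [Real.norm_eq_abs, abs_mul, abs_mul, abs_of_pos hz, abs_of_pos (lt_min hz hL)]
    gcongr
    exact min_le_left _ _
  have hdiff : heatContent1 α t (Set.Ioo a b) (Set.Ioo a b)ᶜ
      - (2 / Real.pi) * Real.Gamma (1 - 1/α) * t ^ (1/α)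
      = 2 * ∫ z in Set.Ioi (b - a), (min z (b - a) - z) * heatKernel1 α t z := by
    have e : 2 / Real.pi * Real.Gamma (1 - 1/α) * t ^ (1/α)
        = 2 * ∫ z in Set.Ioi (0 : ℝ), z * heatKernel1 α t z := by
      rw [integral_mul_heatKernel1 h1 h2 ht]; ring
    rw [heatContent1_Ioo_compl h1 h2 ht hab, e, ← mul_sub, ← integral_sub i2 i1]
    simp only [← sub_mul]
    congr 1
    refine setIntegral_eq_of_subset_of_forall_sdiff_eq_zero measurableSet_Ioi
      (Set.Ioi_subset_Ioi hL.le) fun z hz => ?_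
    rw [min_eq_left (not_lt.1 hz.2), sub_self, zero_mul]
  rw [hdiff, abs_mul, abs_two, mul_assoc 2]
  refine mul_le_mul_of_nonneg_left ?_ zero_le_two
  have hb : ‖∫ z in Set.Ioi (b - a), (min z (b - a) - z) * heatKernel1 α t z‖
      ≤ ∫ z in Set.Ioi (b - a), C * t * z ^ (-α) := by
    refine norm_integral_le_of_norm_le
      ((integrableOn_Ioi_rpow_of_lt (by linarith) hL).const_mul _) ?_
    filter_upwards [ae_restrict_mem measurableSet_Ioi] with z hz
    have hz' : b - a < z := hz
    have hz0 : 0 < z := hL.trans hz'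
    rw [Real.norm_eq_abs, abs_mul, min_eq_right hz'.le, abs_of_neg (by linarith)]
    calc -(b - a - z) * |heatKernel1 α t z| ≤ z * (C * t * z ^ (-1 - α)) := by
          gcongr
          · linarith
          · exact h t z ht hz0
      _ = _ := by
          rw [show -α = 1 + (-1 - α) by ring, Real.rpow_add hz0, Real.rpow_one]; ring
  refine hb.trans_eq ?_
  rw [integral_const_mul, integral_Ioi_rpow_of_lt (by linarith) hL,
    show -α + 1 = -(α - 1) by ring, neg_div_neg_eq]
  ring
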